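/- Fix an integer d ≥ 2. There exist a bounded open set 𝒳 ⊂ ℝ^d and a compact set 𝒴 ⊂ ℝ^d with the following property. Let ρ be the uniform probability measure on 𝒳 (normalized Lebesgue measure restricted to 𝒳). For every C > 0, every p ≥ 1 and every α > p/(2(p+1)) (in particular for α = 1/2), there exist Borel probability measures μ and ν supported in 𝒴, Borel maps T, S : ℝ^d → ℝ^d, and a coupling π of μ and ν, such that (i) the pushforward of ρ by T equals μ and the pushforward of ρ by S equals ν; (ii) T minimizes ∫ |x − T'(x)|² dρ among all Borel maps T' pushing ρ forward to μ, and S minimizes ∫ |x − S'(x)|² dρ among all Borel maps S' pushing ρ forward to ν; (iii) ∫ |T(x) − S(x)|² dρ(x) > C² · (∫ |x − y|^p dπ(x, y))^{2α/p}. In particular, since the p-Wasserstein distance W_p(μ, ν) is at most (∫ |x − y|^p dπ)^{1/p}, the stability inequality ‖T_μ − T_ν‖_{L²(ρ)} ≤ C·W_p(μ, ν)^α for optimal transport maps with source ρ fails for every C > 0, p ≥ 1 and α > p/(2(p+1)). -/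

import Mathlib

open MeasureTheory Metric
open scoped ENNReal

namespace Stmt17

abbrev E (d : ℕ) := EuclideanSpace ℝ (Fin d)

/-- The two-valued optimal map. -/
noncomputable def Tm {d : ℕ} (z : E d) : E d → E d :=
  fun x => if 1 < inner ℝ x z then z else 0

lemma measurableSet_cell {d : ℕ} (z : E d) : MeasurableSet {x : E d | 1 < inner ℝ x z} := by
  apply IsOpen.measurableSet
  exact isOpen_lt continuous_const (by fun_prop)

lemma measurable_Tm {d : ℕ} (z : E d) : Measurable (Tm z) :=
  Measurable.ite (measurableSet_cell z) measurable_const measurable_const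

lemma optimal {d : ℕ} (ρ : Measure (E d)) [IsProbabilityMeasure ρ] (M : ℝ)
    (hM : ∀ᵐ x ∂ρ, ‖x‖ ≤ M) (z : E d) (T' : E d → E d) (hT' : Measurable T')
    (h : ρ.map T' = ρ.map (Tm z)) :
    ∫⁻ x, ENNReal.ofReal (dist x (Tm z x) ^ 2) ∂ρ ≤
      ∫⁻ x, ENNReal.ofReal (dist x (T' x) ^ 2) ∂ρ := by
  classical
  have hT := measurable_Tm z
  set g : E d → ℝ := fun x => 2 * max (inner ℝ x z - 1) 0 with hg
  have hg0 : ∀ x, 0 ≤ g x := fun x => by positivity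
  have hgm : Measurable g := by
    apply Continuous.measurable; fun_prop
  set j : E d → ℝ := fun y => if y = z then 2 else 0 with hj
  have hj0 : ∀ x, 0 ≤ j x := fun x => by
    simp only [hj]; split_ifs <;> norm_num
  have hjm : Measurable j := Measurable.ite (measurableSet_singleton z) measurable_const measurable_const
  have key : ∀ F : E d → E d, Measurable F → ρ.map F = ρ.map (Tm z) →
      ∫⁻ x, ENNReal.ofReal (dist x (F x) ^ 2 + g x + j (F x)) ∂ρ =
      ∫⁻ x, ENNReal.ofReal (dist x (F x) ^ 2) ∂ρ + (∫⁻ x, ENNReal.ofReal (g x) ∂ρ +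
        ∫⁻ y, ENNReal.ofReal (j y) ∂(ρ.map (Tm z))) := by
    intro F hF hFm
    rw [← hFm, lintegral_map (by fun_prop) hF, ← add_assoc, ← lintegral_add_right _ (by fun_prop),
      ← lintegral_add_right _ (by fun_prop)]
    congr 1; ext x
    rw [ENNReal.ofReal_add (by have := hg0 x; positivity) (hj0 _), ENNReal.ofReal_add (by positivity) (hg0 _)]
  have key2 : ∀ F : E d → E d, Measurable F → ρ.map F = ρ.map (Tm z) →
      ∫⁻ x, ENNReal.ofReal (‖x‖ ^ 2 + ‖F x‖ ^ 2) ∂ρ =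
      ∫⁻ x, ENNReal.ofReal (‖x‖ ^ 2) ∂ρ +
        ∫⁻ y, ENNReal.ofReal (‖y‖ ^ 2) ∂(ρ.map (Tm z)) := by
    intro F hF hFm
    rw [← hFm, lintegral_map (by fun_prop) hF, ← lintegral_add_right _ (by fun_prop)]
    congr 1; ext x
    rw [ENNReal.ofReal_add (by positivity) (by positivity)]
  have fin : (∫⁻ x, ENNReal.ofReal (g x) ∂ρ +
        ∫⁻ y, ENNReal.ofReal (j y) ∂(ρ.map (Tm z))) ≠ ⊤ := by
    apply ENNReal.add_ne_top.2 ⟨ne_top_of_le_ne_top (b := ENNReal.ofReal (2 * (M * ‖z‖))) ENNReal.ofReal_ne_top ?_,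
      ne_top_of_le_ne_top (b := ENNReal.ofReal 2) (by simp) ?_⟩
    · calc _ ≤ ∫⁻ x, ENNReal.ofReal (2 * (M * ‖z‖)) ∂ρ := by
            apply lintegral_mono_ae
            filter_upwards [hM] with x hx
            apply ENNReal.ofReal_le_ofReal
            have h1 := real_inner_le_norm x z
            have h2 : ‖x‖ * ‖z‖ ≤ M * ‖z‖ := by gcongr
            have h3 : 0 ≤ ‖x‖ * ‖z‖ := by positivity
            simp only [hg]
            have : max (inner ℝ x z - 1) 0 ≤ M * ‖z‖ := max_le (by linarith) (by linarith)
            linarith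
        _ = _ := by simp
    · have : IsProbabilityMeasure (ρ.map (Tm z)) := Measure.isProbabilityMeasure_map hT.aemeasurable
      calc _ ≤ ∫⁻ x, ENNReal.ofReal 2 ∂(ρ.map (Tm z)) := by
            apply lintegral_mono
            intro x
            apply ENNReal.ofReal_le_ofReal
            simp only [hj]; split_ifs <;> norm_num
        _ = _ := by simp
  rw [← ENNReal.add_le_add_iff_right fin, ← key _ hT rfl, ← key _ hT' h]
  have e1 : ∀ᵐ x ∂ρ, T' x = z ∨ T' x = 0 := by
    have hms : MeasurableSet {y : E d | y = z ∨ y = 0} :=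
      (measurableSet_singleton z).union (measurableSet_singleton 0)
    have : ∀ᵐ y ∂(ρ.map (Tm z)), y = z ∨ y = 0 := by
      rw [ae_map_iff hT.aemeasurable hms]
      refine Filter.Eventually.of_forall fun x => ?_
      unfold Tm; split_ifs <;> simp
    rw [← h, ae_map_iff hT'.aemeasurable hms] at this
    exact this
  have dd : ∀ x y : E d, dist x y ^ 2 = ‖x‖ ^ 2 - 2 * inner ℝ x y + ‖y‖ ^ 2 := fun x y => by
    rw [dist_eq_norm, norm_sub_sq_real]
  by_cases hz : z = 0
  · refine lintegral_mono_ae ?_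
    filter_upwards [e1] with x hx
    have h1 : Tm z x = 0 := by unfold Tm; simp [hz]
    have h2 : T' x = 0 := by rcases hx with h | h <;> simp [h, hz]
    rw [h1, h2]
  calc _ = ∫⁻ x, ENNReal.ofReal (‖x‖ ^ 2 + ‖Tm z x‖ ^ 2) ∂ρ := by
        congr 1; ext x; congr 1
        rw [dd]
        simp only [hg, hj, Tm]
        split_ifs with h1 h2
        · rw [max_eq_left (by linarith)]; ring
        · exact absurd rfl h2
        · rename_i h2; exact absurd h2.symm hz
        · rw [max_eq_right (by linarith)]; simp
    _ = ∫⁻ x, ENNReal.ofReal (‖x‖ ^ 2 + ‖T' x‖ ^ 2) ∂ρ := by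
        rw [key2 _ hT rfl, key2 _ hT' h]
    _ ≤ _ := by
        refine lintegral_mono_ae ?_
        filter_upwards [e1] with x hx
        apply ENNReal.ofReal_le_ofReal
        rw [dd]
        rcases hx with h | h
        · rw [h]; simp only [hg, hj, if_true]
          have := le_max_left (inner ℝ x z - 1) 0
          linarith
        · rw [h]; have := hg0 x; have := hj0 0; simp; linarith

/-- Reflection in coordinate `i`. -/
noncomputable def R {d : ℕ} (i : Fin d) : E d ≃ₗᵢ[ℝ] E d :=
  LinearIsometryEquiv.piLpCongrRight 2
    (fun k => if k = i then LinearIsometryEquiv.neg ℝ else LinearIsometryEquiv.refl ℝ ℝ)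

lemma R_apply {d : ℕ} (i : Fin d) (x : E d) (k : Fin d) :
    R i x k = if k = i then - x k else x k := by
  unfold R
  simp only [LinearIsometryEquiv.piLpCongrRight_apply]
  split_ifs <;> simp

def box {d : ℕ} (l : Fin d → ℝ) : Set (E d) := {x | ∀ i, l i < x i ∧ x i < 1}

lemma box_eq {d : ℕ} (l : Fin d → ℝ) :
    box l = (MeasurableEquiv.toLp 2 (Fin d → ℝ)).symm ⁻¹' (Set.univ.pi fun i => Set.Ioo (l i) 1) := by
  ext x; simp [box]

lemma volume_box {d : ℕ} (l : Fin d → ℝ) : volume (box l) = ∏ i, ENNReal.ofReal (1 - l i) := by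
  rw [box_eq, (EuclideanSpace.volume_preserving_symm_measurableEquiv_toLp (Fin d)).measure_preimage
    (MeasurableSet.univ_pi fun i => measurableSet_Ioo).nullMeasurableSet, Real.volume_pi_Ioo]

lemma isOpen_box {d : ℕ} (l : Fin d → ℝ) : IsOpen (box l) := by
  have : box l = ⋂ i, {x : E d | l i < x i ∧ x i < 1} := by ext; simp [box]
  rw [this]
  refine isOpen_iInter_of_finite fun i => ?_
  have hc : Continuous fun x : E d => x i := by fun_prop
  exact (isOpen_lt continuous_const hc).inter (isOpen_lt hc continuous_const)

noncomputable def zz {d : ℕ} (i j : Fin d) (s : ℝ) : E d :=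
  EuclideanSpace.single i s + EuclideanSpace.single j 1

lemma inner_zz {d : ℕ} (i j : Fin d) (s : ℝ) (x : E d) :
    inner ℝ x (zz i j s) = s * x i + x j := by
  simp [zz, inner_add_right, EuclideanSpace.inner_single_right]

lemma R_zz {d : ℕ} (i j : Fin d) (hij : i ≠ j) (s : ℝ) : R i (zz i j s) = zz i j (-s) := by
  ext k
  rw [R_apply]
  by_cases h : k = i
  · subst h; simp [zz, hij]
  · simp [zz, h]

lemma Tm_R {d : ℕ} (i j : Fin d) (hij : i ≠ j) (s : ℝ) (x : E d) :
    Tm (zz i j (-s)) x = R i (Tm (zz i j s) (R i x)) := by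
  unfold Tm
  simp only [inner_zz, R_apply, if_true, if_neg hij.symm]
  have : -s * x i + x j = s * - x i + x j := by ring
  rw [this]
  split_ifs
  · exact (R_zz i j hij s).symm
  · simp

lemma exists_eps (C p α : ℝ) (hC : 0 < C) (hp : 1 ≤ p) (hα : p / (2 * (p + 1)) < α) :
    ∃ ε : ℝ, 0 < ε ∧ ε < 1 ∧ C ^ 2 * ((ε / 2) * (2 * ε) ^ p) ^ (2 * α / p) < ε / 16 := by
  have hp0 : 0 < p := by linarith
  set β := 2 * α / p with hβ
  have hγ : 0 < (p + 1) * β - 1 := by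
    rw [div_lt_iff₀ (by positivity)] at hα
    have : 1 < (p + 1) * β := by
      rw [hβ, ← mul_div_assoc, lt_div_iff₀ hp0]; linarith
    linarith
  set K := C ^ 2 * ((1 / 2) * 2 ^ p) ^ β with hK
  have hlim : Filter.Tendsto (fun ε : ℝ => K * ε ^ ((p + 1) * β - 1)) (nhdsWithin 0 (Set.Ioi 0))
      (nhds (K * 0)) := by
    apply Filter.Tendsto.const_mul
    have := (Real.continuousAt_rpow_const 0 ((p + 1) * β - 1) (Or.inr hγ.le)).tendsto
    rw [Real.zero_rpow hγ.ne'] at this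
    exact this.mono_left nhdsWithin_le_nhds
  rw [mul_zero] at hlim
  have h1 := hlim.eventually (gt_mem_nhds (show (0 : ℝ) < 1 / 16 by norm_num))
  have h2 : ∀ᶠ ε : ℝ in nhdsWithin 0 (Set.Ioi 0), ε ∈ Set.Ioo (0 : ℝ) 1 :=
    Ioo_mem_nhdsGT one_pos
  obtain ⟨ε, he, h0, h1⟩ := (h1.and h2).exists
  refine ⟨ε, h0, h1, ?_⟩
  have e1 : (ε / 2) * (2 * ε) ^ p = ((1 / 2) * 2 ^ p) * ε ^ (p + 1) := by
    rw [Real.mul_rpow (by norm_num) h0.le, Real.rpow_add_one h0.ne']; ring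
  rw [e1, Real.mul_rpow (by positivity) (by positivity), ← Real.rpow_mul h0.le, ← mul_assoc, ← hK]
  have e2 : ε ^ ((p + 1) * β) = ε ^ ((p + 1) * β - 1) * ε := by
    rw [← Real.rpow_add_one h0.ne']; ring_nf
  rw [e2]
  calc _ = (K * ε ^ ((p + 1) * β - 1)) * ε := by ring
    _ < 1 / 16 * ε := by gcongr
    _ = _ := by ring

end Stmt17

open Stmt17 in
/-- There exist a bounded open set `𝒳 ⊂ ℝ^d` and a compact set `𝒴` such that, for `ρ`
the uniform probability measure on `𝒳`, the stability inequality
`‖T_μ - T_ν‖_{L²(ρ)} ≤ C W_p(μ,ν)^α` fails for every `C > 0`, `p ≥ 1` and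
`α > p/(2(p+1))`: there are probability measures `μ, ν` supported in `𝒴`, optimal
(quadratic-cost minimizing) transport maps `T, S` from `ρ` to `μ, ν`, and a coupling `π`
of `μ` and `ν` with `∫ |T - S|² dρ > C² (∫ |x-y|^p dπ)^{2α/p}`. -/
theorem stmt17 (d : ℕ) (hd : 2 ≤ d) :
    ∃ X Y : Set (EuclideanSpace ℝ (Fin d)),
      IsOpen X ∧ Bornology.IsBounded X ∧ X.Nonempty ∧ IsCompact Y ∧
      ∀ ρ : Measure (EuclideanSpace ℝ (Fin d)),
        ρ = (volume X)⁻¹ • volume.restrict X →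
        ∀ C : ℝ, 0 < C → ∀ p : ℝ, 1 ≤ p → ∀ α : ℝ, p / (2 * (p + 1)) < α →
        ∃ (μ ν : Measure (EuclideanSpace ℝ (Fin d)))
          (T S : EuclideanSpace ℝ (Fin d) → EuclideanSpace ℝ (Fin d))
          (π : Measure (EuclideanSpace ℝ (Fin d) × EuclideanSpace ℝ (Fin d))),
          IsProbabilityMeasure μ ∧ IsProbabilityMeasure ν ∧
          μ Yᶜ = 0 ∧ ν Yᶜ = 0 ∧
          Measurable T ∧ Measurable S ∧
          ρ.map T = μ ∧ ρ.map S = ν ∧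
          (∀ T' : EuclideanSpace ℝ (Fin d) → EuclideanSpace ℝ (Fin d),
            Measurable T' → ρ.map T' = μ →
            ∫⁻ x, ENNReal.ofReal (dist x (T x) ^ 2) ∂ρ ≤
              ∫⁻ x, ENNReal.ofReal (dist x (T' x) ^ 2) ∂ρ) ∧
          (∀ S' : EuclideanSpace ℝ (Fin d) → EuclideanSpace ℝ (Fin d),
            Measurable S' → ρ.map S' = ν →
            ∫⁻ x, ENNReal.ofReal (dist x (S x) ^ 2) ∂ρ ≤
              ∫⁻ x, ENNReal.ofReal (dist x (S' x) ^ 2) ∂ρ) ∧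
          IsProbabilityMeasure π ∧ π.fst = μ ∧ π.snd = ν ∧
          ENNReal.ofReal (C ^ 2) *
              (∫⁻ z, ENNReal.ofReal (dist z.1 z.2 ^ p) ∂π) ^ (2 * α / p) <
            ∫⁻ x, ENNReal.ofReal (dist (T x) (S x) ^ 2) ∂ρ := by
  classical
  obtain ⟨i, j, hij⟩ : ∃ i j : Fin d, i ≠ j := ⟨⟨0, by omega⟩, ⟨1, by omega⟩, by simp⟩
  set X : Set (EuclideanSpace ℝ (Fin d)) := box (fun _ => -1) with hX
  have hXo : IsOpen X := isOpen_box _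
  have hXn : ∀ x ∈ X, ‖x‖ ≤ d := by
    intro x hx
    rw [EuclideanSpace.norm_eq]
    apply Real.sqrt_le_iff.2 ⟨by positivity, ?_⟩
    calc ∑ k, ‖x k‖ ^ 2 ≤ ∑ k : Fin d, (1 : ℝ) := by
          apply Finset.sum_le_sum
          intro k _
          have := hx k
          rw [Real.norm_eq_abs, sq_abs]
          nlinarith
      _ = d := by simp
      _ ≤ (d : ℝ) ^ 2 := by
          have : (2 : ℝ) ≤ d := by exact_mod_cast hd
          nlinarith
  have hvol : volume X = 2 ^ d := by
    rw [hX, volume_box]; norm_num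
  refine ⟨X, closedBall 0 2, hXo, ?_, ⟨0, fun k => by simp⟩, isCompact_closedBall _ _, ?_⟩
  · exact isBounded_iff_forall_norm_le.2 ⟨d, hXn⟩
  intro ρ hρ C hC p hp α hα
  obtain ⟨ε, h0, h1, hε⟩ := exists_eps C p α hC hp hα
  have hvol0 : volume X ≠ 0 := by rw [hvol]; simp
  have hvolt : volume X ≠ ⊤ := by rw [hvol]; simp
  have hprob : IsProbabilityMeasure ρ := ⟨by
    rw [hρ]; simp [ENNReal.inv_mul_cancel hvol0 hvolt]⟩
  have hae : ∀ᵐ x ∂ρ, x ∈ X := by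
    rw [hρ]
    exact Measure.ae_smul_measure (ae_restrict_mem hXo.measurableSet) _
  have hM : ∀ᵐ x ∂ρ, ‖x‖ ≤ d := hae.mono hXn
  have hρap : ∀ l : Fin d → ℝ, ∀ A : Set (EuclideanSpace ℝ (Fin d)), MeasurableSet A →
      ρ A = (volume X)⁻¹ * volume (A ∩ X) := by
    intro l A hA
    rw [hρ, Measure.smul_apply, Measure.restrict_apply hA, smul_eq_mul]
  have hprod : ∀ a b : ℝ, 0 ≤ a → 0 ≤ b →
      volume (box fun k => 1 - 2 * ((if k = i then a else 1) * (if k = j then b else 1))) =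
      volume X * ENNReal.ofReal (a * b) := by
    intro a b ha hb
    rw [volume_box, hvol, ENNReal.ofReal_mul ha]
    have : ∀ k : Fin d, ENNReal.ofReal (1 - (1 - 2 * ((if k = i then a else 1) * (if k = j then b else 1))))
      = 2 * ((if k = i then ENNReal.ofReal a else 1) * (if k = j then ENNReal.ofReal b else 1)) := by
      intro k
      rw [sub_sub_cancel, ENNReal.ofReal_mul (by norm_num), ENNReal.ofReal_mul (by split_ifs <;> positivity)]
      congr 1
      · simp
      · congr 1 <;> split_ifs <;> simp
    simp_rw [this, Finset.prod_mul_distrib, Finset.prod_ite_eq']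
    simp
  set A : Set (EuclideanSpace ℝ (Fin d)) := {x | 1 < inner ℝ x (zz i j ε)} with hA
  have hAm : MeasurableSet A := measurableSet_cell _
  have hAlow : ENNReal.ofReal (ε / 16) ≤ ρ A := by
    rw [hρap 0 A hAm]
    have hsub : box (fun k => 1 - 2 * ((if k = i then 1 / 4 else 1) * (if k = j then ε / 4 else 1))) ⊆ A ∩ X := by
      intro x hx
      have hi := hx i
      have hj := hx j
      simp only [if_true, if_neg hij, if_neg hij.symm] at hi hj
      refine ⟨?_, fun k => ⟨?_, (hx k).2⟩⟩
      · rw [hA, Set.mem_setOf_eq, inner_zz]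
        nlinarith
      · have := (hx k).1
        simp only at this ⊢
        split_ifs at this <;> linarith
    have := measure_mono (μ := volume) hsub
    rw [hprod _ _ (by norm_num) (by positivity)] at this
    calc _ = (volume X)⁻¹ * (volume X * ENNReal.ofReal (1 / 4 * (ε / 4))) := by
          rw [← mul_assoc, ENNReal.inv_mul_cancel hvol0 hvolt, one_mul]; congr 1; ring
      _ ≤ _ := by gcongr
  have hAup : ρ A ≤ ENNReal.ofReal (ε / 2) := by
    rw [hρap 0 A hAm]
    have hsub : A ∩ X ⊆ box (fun k => 1 - 2 * ((if k = i then 1 else 1) * (if k = j then ε / 2 else 1))) := by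
      rintro x ⟨hxA, hx⟩ k
      rw [hA, Set.mem_setOf_eq, inner_zz] at hxA
      have hi := hx i
      refine ⟨?_, (hx k).2⟩
      have := (hx k).1
      simp only at this ⊢
      split_ifs with h2 h3 h3
      · exact absurd (h2.symm.trans h3) hij
      · linarith
      · subst h3; nlinarith
      · linarith
    have := measure_mono (μ := volume) hsub
    rw [hprod _ _ (by norm_num) (by positivity)] at this
    calc _ ≤ (volume X)⁻¹ * (volume X * ENNReal.ofReal (1 * (ε / 2))) := by gcongr
      _ = _ := by
          rw [← mul_assoc, ENNReal.inv_mul_cancel hvol0 hvolt, one_mul]; congr 1; ring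
  have hRm : Measurable (R i) := (R i).continuous.measurable
  have hRX : R i ⁻¹' X = X := by
    ext x
    simp only [Set.mem_preimage, hX, box, Set.mem_setOf_eq, R_apply]
    refine forall_congr' fun k => ?_
    split_ifs
    · constructor <;> rintro ⟨h, h'⟩ <;> constructor <;> linarith
    · rfl
  have hRρ : ρ.map (R i) = ρ := by
    have h := (R i).measurePreserving.restrict_preimage hXo.measurableSet
    rw [hRX] at h
    rw [hρ, Measure.map_smul, h.map_eq]
  set T := Tm (zz i j ε) with hTdef
  set S := Tm (zz i j (-ε)) with hSdef
  have hT : Measurable T := measurable_Tm _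
  have hS : Measurable S := measurable_Tm _
  have hnorm1 : ∀ s : ℝ, ‖zz i j s‖ ^ 2 = s ^ 2 + 1 := by
    intro s
    rw [← real_inner_self_eq_norm_sq, inner_zz]
    simp [zz, hij, hij.symm]; ring
  have hY : ∀ s : ℝ, s ^ 2 ≤ 1 → (ρ.map (Tm (zz i j s))) (closedBall 0 2)ᶜ = 0 := by
    intro s hs
    rw [Measure.map_apply (measurable_Tm _) measurableSet_closedBall.compl]
    convert measure_empty (μ := ρ)
    ext x
    simp only [Set.mem_preimage, Set.mem_compl_iff, mem_closedBall, dist_zero_right,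
      Set.mem_empty_iff_false, iff_false, not_not]
    unfold Tm
    split_ifs
    · have := hnorm1 s
      nlinarith [norm_nonneg (zz i j s)]
    · simp
  have hSR : S = fun x => R i (T (R i x)) := by
    funext x; exact Tm_R i j hij ε x
  have hπm : Measurable (fun x => (T x, R i (T x))) := hT.prodMk (hRm.comp hT)
  refine ⟨ρ.map T, ρ.map S, T, S, ρ.map (fun x => (T x, R i (T x))),
    Measure.isProbabilityMeasure_map hT.aemeasurable, Measure.isProbabilityMeasure_map hS.aemeasurable,
    hY _ (by nlinarith), hY _ (by nlinarith), hT, hS, rfl, rfl,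
    fun T' hT' h => optimal ρ d hM _ T' hT' h,
    fun T' hT' h => optimal ρ d hM _ T' hT' h,
    Measure.isProbabilityMeasure_map hπm.aemeasurable, ?_, ?_, ?_⟩
  · rw [Measure.fst, Measure.map_map measurable_fst hπm]; rfl
  · rw [Measure.snd, Measure.map_map measurable_snd hπm]
    conv_lhs => rw [← hRρ]
    rw [Measure.map_map (measurable_snd.comp hπm) hRm, hSR]; rfl
  have hp0 : 0 < p := by linarith
  have hα0 : 0 < α := lt_trans (by positivity) hα
  have hL : ∫⁻ z, ENNReal.ofReal (dist z.1 z.2 ^ p) ∂(ρ.map (fun x => (T x, R i (T x)))) ≤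
      ENNReal.ofReal ((ε / 2) * (2 * ε) ^ p) := by
    rw [lintegral_map (by fun_prop) hπm]
    calc _ = ∫⁻ x, A.indicator (fun _ => ENNReal.ofReal ((2 * ε) ^ p)) x ∂ρ := by
          congr 1; ext x
          by_cases hx : x ∈ A
          · have : T x = zz i j ε := if_pos hx
            rw [Set.indicator_of_mem hx]
            simp only [this, R_zz i j hij]
            congr 2
            rw [dist_eq_norm]
            have : zz i j ε - zz i j (-ε) = EuclideanSpace.single i (2 * ε) := by
              ext k
              by_cases hk : k = i
              · subst hk; simp [zz, hij]; ring
              · simp [zz, hk]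
            rw [this]; simp [abs_of_pos h0]
          · have : T x = 0 := if_neg hx
            rw [Set.indicator_of_notMem hx]
            simp [this, Real.zero_rpow hp0.ne']
      _ = ENNReal.ofReal ((2 * ε) ^ p) * ρ A := by
          rw [lintegral_indicator_const hAm]
      _ ≤ ENNReal.ofReal ((2 * ε) ^ p) * ENNReal.ofReal (ε / 2) := by gcongr
      _ = _ := by rw [mul_comm, ENNReal.ofReal_mul (by positivity)]
  calc _ ≤ ENNReal.ofReal (C ^ 2) * (ENNReal.ofReal ((ε / 2) * (2 * ε) ^ p)) ^ (2 * α / p) := by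
        gcongr
    _ = ENNReal.ofReal (C ^ 2 * ((ε / 2) * (2 * ε) ^ p) ^ (2 * α / p)) := by
        rw [ENNReal.ofReal_rpow_of_nonneg (by positivity) (by positivity),
          ENNReal.ofReal_mul (by positivity)]
    _ < ENNReal.ofReal (ε / 16) := (ENNReal.ofReal_lt_ofReal_iff (by positivity)).2 hε
    _ ≤ ρ A := hAlow
    _ = ∫⁻ x, A.indicator (fun _ => 1) x ∂ρ := by
        rw [lintegral_indicator_const hAm, one_mul]
    _ ≤ _ := by
        refine lintegral_mono_ae ?_
        filter_upwards [hae] with x hxX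
        by_cases hx : x ∈ A
        · have e1 : T x = zz i j ε := if_pos hx
          have e2 : S x = 0 := by
            refine if_neg ?_
            rw [inner_zz]
            rw [hA, Set.mem_setOf_eq, inner_zz] at hx
            have := (hxX j).2
            nlinarith
          rw [Set.indicator_of_mem hx, e1, e2, dist_zero_right, hnorm1]
          rw [← ENNReal.ofReal_one]
          apply ENNReal.ofReal_le_ofReal
          nlinarith
        · rw [Set.indicator_of_notMem hx]; exact zero_le
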